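/- Let P^S and P^T be probability measures on measurable spaces X^S and X^T, and let f^S : X^S -> Y_Delta and f^T : X^T -> Y_Delta be measurable maps into a metric space (Y_Delta, d_Y). Let P_{f^S} = f^S # P^S and P_{f^T} = f^T # P^T be the pushforward measures. Then for every coupling gamma of (P_{f^S}, P_{f^T}), there exists a coupling gamma' of (P^S, P^T) such that (f^S, f^T) # gamma' = gamma. -/

import Mathlib

open MeasureTheory

open ProbabilityTheory in
lemma exists_lift_kernel {X Y : Type*}
    [MeasurableSpace X] [StandardBorelSpace X]
    [MeasurableSpace Y] [StandardBorelSpace Y]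
    (P : Measure X) [IsProbabilityMeasure P] (f : X → Y) (hf : Measurable f) :
    ∃ κ : Kernel Y X, IsMarkovKernel κ ∧ (P.map f).bind κ = P ∧
      ∀ᵐ y ∂(P.map f), (κ y).map f = Measure.dirac y := by
  have : Nonempty X := P.nonempty_of_neZero
  have : Nonempty Y := ⟨f (Classical.arbitrary X)⟩
  refine ⟨condDistrib id f P, inferInstance, ?_, ?_⟩
  · rw [condDistrib_comp_map hf.aemeasurable aemeasurable_id, Measure.map_id]
  · have h1 := condDistrib_comp (μ := P) (mβ := ‹MeasurableSpace Y›) f (Y := id) aemeasurable_id hf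
    have h2 := condDistrib_self (μ := P) f
    rw [Function.comp_id] at h1
    filter_upwards [h1, h2] with y h1 h2
    rw [← Kernel.map_apply _ hf, ← h1, h2, Kernel.id_apply]

/-- gluing lemma: for every coupling `γ` of the pushforward measures
`f^S # P^S` and `f^T # P^T`, there exists a coupling `γ'` of `(P^S, P^T)` such that
`(f^S, f^T) # γ' = γ`. -/
theorem stmt2 {XS XT Y : Type*}
    [MeasurableSpace XS] [StandardBorelSpace XS]
    [MeasurableSpace XT] [StandardBorelSpace XT]
    [MeasurableSpace Y] [StandardBorelSpace Y]
    (PS : Measure XS) (PT : Measure XT)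
    [IsProbabilityMeasure PS] [IsProbabilityMeasure PT]
    (fS : XS → Y) (fT : XT → Y) (hfS : Measurable fS) (hfT : Measurable fT)
    (γ : Measure (Y × Y)) [IsProbabilityMeasure γ]
    (hγ1 : γ.map Prod.fst = PS.map fS) (hγ2 : γ.map Prod.snd = PT.map fT) :
    ∃ γ' : Measure (XS × XT), IsProbabilityMeasure γ' ∧
      γ'.map Prod.fst = PS ∧ γ'.map Prod.snd = PT ∧
      γ'.map (Prod.map fS fT) = γ := by
  obtain ⟨κ, hκ, hκ1, hκ2⟩ := exists_lift_kernel PS fS hfS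
  obtain ⟨η, hη, hη1, hη2⟩ := exists_lift_kernel PT fT hfT
  rw [← hγ1] at hκ1 hκ2
  rw [← hγ2] at hη1 hη2
  have hκ3 := ae_of_ae_map measurable_fst.aemeasurable hκ2
  have hη3 := ae_of_ae_map measurable_snd.aemeasurable hη2
  have key : ∀ s, MeasurableSet s → γ.bind (ProbabilityTheory.Kernel.parallelComp κ η) s
      = ∫⁻ p, ((κ p.1).prod (η p.2)) s ∂γ := by
    intro s hs
    rw [Measure.bind_apply hs (ProbabilityTheory.Kernel.aemeasurable _)]
    simp only [ProbabilityTheory.Kernel.parallelComp_apply]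
  refine ⟨γ.bind (ProbabilityTheory.Kernel.parallelComp κ η), inferInstance, ?_, ?_, ?_⟩
  · conv_rhs => rw [← hκ1]
    ext s hs
    rw [Measure.map_apply measurable_fst hs, key _ (measurable_fst hs),
      Measure.bind_apply hs (ProbabilityTheory.Kernel.aemeasurable _),
      lintegral_map (ProbabilityTheory.Kernel.measurable_coe _ hs) measurable_fst]
    refine lintegral_congr fun p => ?_
    rw [← Measure.map_apply measurable_fst hs, Measure.map_fst_prod]
    simp
  · conv_rhs => rw [← hη1]
    ext s hs
    rw [Measure.map_apply measurable_snd hs, key _ (measurable_snd hs),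
      Measure.bind_apply hs (ProbabilityTheory.Kernel.aemeasurable _),
      lintegral_map (ProbabilityTheory.Kernel.measurable_coe _ hs) measurable_snd]
    refine lintegral_congr fun p => ?_
    rw [← Measure.map_apply measurable_snd hs, Measure.map_snd_prod]
    simp
  · ext s hs
    have hm : Measurable (Prod.map fS fT) := hfS.prodMap hfT
    rw [Measure.map_apply hm hs, key _ (hm hs), ← lintegral_indicator_one hs]
    refine lintegral_congr_ae ?_
    filter_upwards [hκ3, hη3] with p h1 h2
    rw [← Measure.map_apply hm hs, ← Measure.map_prod_map _ _ hfS hfT, h1, h2,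
      Measure.dirac_prod_dirac, Measure.dirac_apply' _ hs]
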